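/- arXiv:1601.03911 — 2 statements merged into one kernel-verified Lean document; each statement's English description precedes it below -/
import Mathlib

section
/- Let α ∈ (1,2], β₁ > 1/(α−1) and β₂ > 1/(α−1). Then the doubly-indexed limit, as n → ∞ and m → ∞ (along the product filter), of ρ(n,m)/(n^{−β₁} m^{−β₂}) exists and equals Σ_{i=0}^∞ Σ_{j=0}^∞ w_{(i,j)}^{⟨α−1⟩} (1+i)^{−β₁(α−1)} (1+j)^{−β₂(α−1)}, where x^{⟨a⟩} := |x|^a · sign(x) denotes the signed power. -/
open Filter MeasureTheory Real Set

/-- The kernel `V(x,y) = xy/(x^2+y^2)^{(2-α)/2}` with `V(0,0)=0`. -/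
noncomputable def V (α : ℝ) : ℝ → ℝ → ℝ := fun x y =>
  if x = 0 ∧ y = 0 then 0 else x * y / (x ^ 2 + y ^ 2) ^ ((2 - α) / 2)

lemma aux_bdd_seq (f : ℕ → ℝ) (l : ℝ) (h : Tendsto f atTop (nhds l)) :
    ∃ B : ℝ, 0 ≤ B ∧ ∀ n, |f n| ≤ B := by
  obtain ⟨B, hB⟩ := h.abs.bddAbove_range
  exact ⟨B, (abs_nonneg (f 0)).trans (hB ⟨0, rfl⟩), fun n => hB ⟨n, rfl⟩⟩

lemma aux_bdd (w : ℕ → ℕ → ℝ)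
    (hA1 : Tendsto (fun p : ℕ × ℕ => w p.1 p.2) (atTop ×ˢ atTop) (nhds 1))
    (winf : ℕ → ℝ) (hA2 : ∀ i, Tendsto (fun j => w i j) atTop (nhds (winf i)))
    (wco : ℕ → ℝ) (hA3 : ∀ j, Tendsto (fun i => w i j) atTop (nhds (wco j))) :
    ∃ W : ℝ, 0 ≤ W ∧ ∀ i j, |w i j| ≤ W := by
  have h1 : ∀ᶠ p : ℕ × ℕ in atTop ×ˢ atTop, |w p.1 p.2| < 2 :=
    hA1.abs.eventually (gt_mem_nhds (by norm_num))
  rw [prod_atTop_atTop_eq, eventually_atTop] at h1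
  obtain ⟨⟨N, M⟩, hN⟩ := h1
  choose B hB0 hB using fun i => aux_bdd_seq _ _ (hA2 i)
  choose C hC0 hC using fun j => aux_bdd_seq _ _ (hA3 j)
  have hSB : 0 ≤ ∑ i ∈ Finset.range N, B i := Finset.sum_nonneg fun i _ => hB0 i
  have hSC : 0 ≤ ∑ i ∈ Finset.range M, C i := Finset.sum_nonneg fun i _ => hC0 i
  refine ⟨2 + ∑ i ∈ Finset.range N, B i + ∑ j ∈ Finset.range M, C j, by positivity, fun i j => ?_⟩
  by_cases hi : i < N
  · have := Finset.single_le_sum (f := B) (fun i _ => hB0 i) (Finset.mem_range.2 hi)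
    linarith [hB i j]
  by_cases hj : j < M
  · have := Finset.single_le_sum (f := C) (fun i _ => hC0 i) (Finset.mem_range.2 hj)
    linarith [hC j i]
  have := hN (i, j) ⟨not_lt.1 hi, not_lt.1 hj⟩
  simp only at this
  linarith

lemma aux_pow (α x : ℝ) : (x ^ 2) ^ ((2 - α) / 2) = |x| ^ (2 - α) := by
  rw [← sq_abs, ← Real.rpow_natCast, ← Real.rpow_mul (abs_nonneg x)]
  congr 1
  push_cast
  ring

lemma aux_V (α x y : ℝ) (hx : x ≠ 0) :
    V α x y = x * y / (x ^ 2 + y ^ 2) ^ ((2 - α) / 2) := by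
  simp [V, hx]

lemma aux_V_le (α x y : ℝ) (hα2 : α ≤ 2) (hx : x ≠ 0) :
    |V α x y| ≤ |x| ^ (α - 1) * |y| := by
  have hx' : 0 < |x| := abs_pos.2 hx
  have hx2 : 0 < x ^ 2 := by positivity
  rw [aux_V α x y hx, abs_div, abs_mul]
  have h1 : |x| ^ (2 - α) ≤ (x ^ 2 + y ^ 2) ^ ((2 - α) / 2) := by
    rw [← aux_pow]
    exact Real.rpow_le_rpow hx2.le (by nlinarith [sq_nonneg y]) (by linarith)
  have h2 : 0 < |x| ^ (2 - α) := Real.rpow_pos_of_pos hx' _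
  rw [abs_of_nonneg (h2.le.trans h1), div_le_iff₀ (h2.trans_le h1)]
  have h3 : |x| = |x| ^ (α - 1) * |x| ^ (2 - α) := by
    rw [← Real.rpow_add hx']
    norm_num
  have h4 : 0 ≤ |x| ^ (α - 1) * |y| := by positivity
  calc |x| * |y| = |x| ^ (α - 1) * |y| * |x| ^ (2 - α) := by
        nth_rewrite 1 [h3]; ring
    _ ≤ _ := mul_le_mul_of_nonneg_left h1 h4

lemma aux_signed (α x : ℝ) (hx : x ≠ 0) :
    x / (x ^ 2) ^ ((2 - α) / 2) = Real.sign x * |x| ^ (α - 1) := by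
  have hx' : 0 < |x| := abs_pos.2 hx
  rw [aux_pow, div_eq_iff (Real.rpow_pos_of_pos hx' _).ne', mul_assoc, ← Real.rpow_add hx']
  norm_num
  rcases lt_or_gt_of_ne hx with h | h
  · simp [Real.sign_of_neg h, abs_of_neg h]
  · simp [Real.sign_of_pos h, abs_of_pos h]

lemma aux_ratio (β : ℝ) (i : ℕ) :
    Tendsto (fun n : ℕ => (1 + ((i + n : ℕ) : ℝ)) ^ (-β) / (n : ℝ) ^ (-β)) atTop (nhds 1) := by
  have h : Tendsto (fun n : ℕ => (1 + (1 + (i : ℝ)) / (n : ℝ))) atTop (nhds 1) := by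
    simpa using (tendsto_const_div_atTop_nhds_zero_nat (1 + (i : ℝ))).const_add 1
  have h2 := h.rpow_const (p := -β) (Or.inl one_ne_zero)
  rw [Real.one_rpow] at h2
  refine h2.congr' ?_
  filter_upwards [eventually_gt_atTop 0] with n hn
  have hn' : (0 : ℝ) < n := by exact_mod_cast hn
  rw [← Real.div_rpow (by positivity) hn'.le]
  congr 1
  push_cast
  field_simp
  ring

lemma aux_sum (γ : ℝ) (h : 1 < γ) : Summable (fun i : ℕ => (1 + (i : ℝ)) ^ (-γ)) := by
  have := (summable_nat_add_iff 1).2 (Real.summable_nat_rpow.2 (neg_lt_neg h))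
  refine this.congr fun i => ?_
  push_cast
  rw [add_comm]

lemma aux_le (β : ℝ) (hβ : 0 < β) (i n : ℕ) (hn : 1 ≤ n) :
    (1 + ((i + n : ℕ) : ℝ)) ^ (-β) ≤ (n : ℝ) ^ (-β) := by
  have hn' : (0 : ℝ) < n := by exact_mod_cast hn
  refine Real.rpow_le_rpow_of_nonpos hn' ?_ (by linarith)
  push_cast
  have : (0 : ℝ) ≤ i := by positivity
  linarith

theorem stmt0 (α β₁ β₂ : ℝ)
    (hα : 1 < α) (hα2 : α ≤ 2)
    (hβ₁ : 1 / (α - 1) < β₁) (hβ₂ : 1 / (α - 1) < β₂)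
    (w : ℕ → ℕ → ℝ) (hw : ∀ i j, w i j ≠ 0)
    (hA1 : Tendsto (fun p : ℕ × ℕ => w p.1 p.2) (atTop ×ˢ atTop) (nhds 1))
    (winf : ℕ → ℝ)
    (hA2 : ∀ i, Tendsto (fun j => w i j) atTop (nhds (winf i)) ∧ 0 < winf i)
    (wco : ℕ → ℝ)
    (hA3 : ∀ j, Tendsto (fun i => w i j) atTop (nhds (wco j)) ∧ 0 < wco j)
    (c : ℕ → ℕ → ℝ)
    (hc : ∀ i j, c i j = w i j * (1 + (i : ℝ)) ^ (-β₁) * (1 + (j : ℝ)) ^ (-β₂))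
    (ρ : ℕ → ℕ → ℝ)
    (hsum : ∀ n m : ℕ, 1 ≤ n → 1 ≤ m →
      Summable (fun q : ℕ × ℕ => V α (c q.1 q.2) (c (q.1 + n) (q.2 + m))))
    (hρ : ∀ n m : ℕ, 1 ≤ n → 1 ≤ m →
      ρ n m = ∑' i : ℕ, ∑' j : ℕ, V α (c i j) (c (i + n) (j + m)))
    :
    Tendsto (fun p : ℕ × ℕ => ρ p.1 p.2 / ((p.1 : ℝ) ^ (-β₁) * (p.2 : ℝ) ^ (-β₂)))
      (atTop ×ˢ atTop)
      (nhds (∑' i : ℕ, ∑' j : ℕ,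
        Real.sign (w i j) * |w i j| ^ (α - 1) *
          (1 + (i : ℝ)) ^ (-(β₁ * (α - 1))) * (1 + (j : ℝ)) ^ (-(β₂ * (α - 1))))) := by
  have ha : 0 < α - 1 := by linarith
  have hb1 : 1 < β₁ * (α - 1) := by rwa [div_lt_iff₀ ha] at hβ₁
  have hb2 : 1 < β₂ * (α - 1) := by rwa [div_lt_iff₀ ha] at hβ₂
  have hp1 : 0 < β₁ := lt_trans (by positivity) hβ₁
  have hp2 : 0 < β₂ := lt_trans (by positivity) hβ₂
  obtain ⟨W, hW0, hW⟩ := aux_bdd w hA1 winf (fun i => (hA2 i).1) wco (fun j => (hA3 j).1)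
  set bound : ℕ × ℕ → ℝ := fun q => (W ^ (α - 1) * W) *
    ((1 + (q.1 : ℝ)) ^ (-(β₁ * (α - 1))) * (1 + (q.2 : ℝ)) ^ (-(β₂ * (α - 1)))) with hbound
  have hbs : Summable bound := by
    refine Summable.mul_left _ ?_
    exact (aux_sum _ hb1).mul_of_nonneg (aux_sum _ hb2)
      (fun i => by positivity) (fun i => by positivity)
  have hcne : ∀ i j, c i j ≠ 0 := fun i j => by
    rw [hc]
    have := hw i j
    have h1 : (0 : ℝ) < (1 + (i : ℝ)) ^ (-β₁) := by positivity
    have h2 : (0 : ℝ) < (1 + (j : ℝ)) ^ (-β₂) := by positivity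
    exact mul_ne_zero (mul_ne_zero this h1.ne') h2.ne'
  have hcabs : ∀ i j, |c i j| ^ (α - 1) = |w i j| ^ (α - 1) *
      (1 + (i : ℝ)) ^ (-(β₁ * (α - 1))) * (1 + (j : ℝ)) ^ (-(β₂ * (α - 1))) := fun i j => by
    have h1 : (0 : ℝ) < (1 + (i : ℝ)) ^ (-β₁) := by positivity
    have h2 : (0 : ℝ) < (1 + (j : ℝ)) ^ (-β₂) := by positivity
    rw [hc, abs_mul, abs_mul, abs_of_pos h1, abs_of_pos h2, Real.mul_rpow (by positivity) h2.le,
      Real.mul_rpow (by positivity) h1.le, ← Real.rpow_mul (by positivity),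
      ← Real.rpow_mul (by positivity), neg_mul, neg_mul]
  have hsign : ∀ i j, Real.sign (c i j) = Real.sign (w i j) := fun i j => by
    have h1 : (0 : ℝ) < (1 + (i : ℝ)) ^ (-β₁) * (1 + (j : ℝ)) ^ (-β₂) := by positivity
    rw [hc, mul_assoc]
    rcases lt_or_gt_of_ne (hw i j) with h | h
    · rw [Real.sign_of_neg h, Real.sign_of_neg (mul_neg_of_neg_of_pos h h1)]
    · rw [Real.sign_of_pos h, Real.sign_of_pos (mul_pos h h1)]
  set f : ℕ × ℕ → ℕ × ℕ → ℝ := fun p q =>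
    V α (c q.1 q.2) (c (q.1 + p.1) (q.2 + p.2)) / ((p.1 : ℝ) ^ (-β₁) * (p.2 : ℝ) ^ (-β₂)) with hf
  set g : ℕ × ℕ → ℝ := fun q => Real.sign (w q.1 q.2) * |w q.1 q.2| ^ (α - 1) *
          (1 + (q.1 : ℝ)) ^ (-(β₁ * (α - 1))) * (1 + (q.2 : ℝ)) ^ (-(β₂ * (α - 1))) with hg
  have hge1 : ∀ᶠ p : ℕ × ℕ in atTop ×ˢ atTop, 1 ≤ p.1 ∧ 1 ≤ p.2 :=
    (eventually_ge_atTop 1).prod_mk (eventually_ge_atTop 1)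
  have hlim : ∀ q, Tendsto (f · q) (atTop ×ˢ atTop) (nhds (g q)) := by
    rintro ⟨i, j⟩
    have hr : Tendsto (fun p : ℕ × ℕ => c (i + p.1) (j + p.2) /
        ((p.1 : ℝ) ^ (-β₁) * (p.2 : ℝ) ^ (-β₂))) (atTop ×ˢ atTop) (nhds 1) := by
      have t1 := (aux_ratio β₁ i).comp (tendsto_fst (f := (atTop : Filter ℕ)) (g := (atTop : Filter ℕ)))
      have t2 := (aux_ratio β₂ j).comp (tendsto_snd (f := (atTop : Filter ℕ)) (g := (atTop : Filter ℕ)))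
      have t3 : Tendsto (fun p : ℕ × ℕ => w (i + p.1) (j + p.2)) (atTop ×ˢ atTop) (nhds 1) :=
        hA1.comp (Tendsto.prodMap (f := fun n : ℕ => i + n) (g := fun n : ℕ => j + n)
          (tendsto_atTop_mono (fun n => Nat.le_add_left n i) tendsto_id)
          (tendsto_atTop_mono (fun n => Nat.le_add_left n j) tendsto_id))
      have := (t3.mul t1).mul t2
      simp only [mul_one] at this
      refine this.congr fun p => ?_
      simp only [Function.comp, hc]
      rw [div_eq_mul_inv, div_eq_mul_inv, div_eq_mul_inv, mul_inv]
      ring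
    have hd : Tendsto (fun p : ℕ × ℕ => (p.1 : ℝ) ^ (-β₁) * (p.2 : ℝ) ^ (-β₂))
        (atTop ×ˢ atTop) (nhds 0) := by
      have t1 := ((tendsto_rpow_neg_atTop hp1).comp tendsto_natCast_atTop_atTop).comp
        (tendsto_fst (f := (atTop : Filter ℕ)) (g := (atTop : Filter ℕ)))
      have t2 := ((tendsto_rpow_neg_atTop hp2).comp tendsto_natCast_atTop_atTop).comp
        (tendsto_snd (f := (atTop : Filter ℕ)) (g := (atTop : Filter ℕ)))
      simpa [Function.comp_def] using t1.mul t2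
    have hy : Tendsto (fun p : ℕ × ℕ => c (i + p.1) (j + p.2)) (atTop ×ˢ atTop) (nhds 0) := by
      have := hr.mul hd
      rw [mul_zero] at this
      refine this.congr' ?_
      filter_upwards [hge1] with p hp
      have h1 : (0 : ℝ) < p.1 := by exact_mod_cast hp.1
      have h2 : (0 : ℝ) < p.2 := by exact_mod_cast hp.2
      have h3 : (0 : ℝ) < (p.1 : ℝ) ^ (-β₁) * (p.2 : ℝ) ^ (-β₂) := by positivity
      exact div_mul_cancel₀ _ h3.ne'
    have hx2 : 0 < (c i j) ^ 2 := by have := hcne i j; positivity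
    have hden : Tendsto (fun p : ℕ × ℕ =>
        ((c i j) ^ 2 + (c (i + p.1) (j + p.2)) ^ 2) ^ ((2 - α) / 2))
        (atTop ×ˢ atTop) (nhds (((c i j) ^ 2) ^ ((2 - α) / 2))) := by
      have h := (hy.pow 2).const_add ((c i j) ^ 2)
      simp only [ne_eq, OfNat.ofNat_ne_zero, not_false_eq_true, zero_pow, add_zero] at h
      exact h.rpow_const (Or.inl hx2.ne')
    have hall := (hr.const_mul (c i j)).div hden (Real.rpow_pos_of_pos hx2 _).ne'
    rw [mul_one, aux_signed _ _ (hcne i j), hsign, hcabs] at hall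
    have e : g (i, j) = Real.sign (w i j) * (|w i j| ^ (α - 1) *
      (1 + (i : ℝ)) ^ (-(β₁ * (α - 1))) * (1 + (j : ℝ)) ^ (-(β₂ * (α - 1)))) := by
      simp only [hg]; ring
    rw [e]
    refine hall.congr fun p => ?_
    simp only [hf, Pi.div_apply]
    rw [aux_V _ _ _ (hcne i j)]
    simp only [div_eq_mul_inv]
    ring
  have hle : ∀ᶠ p in atTop ×ˢ atTop, ∀ q, ‖f p q‖ ≤ bound q := by
    filter_upwards [hge1] with p hp
    rintro ⟨i, j⟩
    have h1 : (0 : ℝ) < p.1 := by exact_mod_cast hp.1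
    have h2 : (0 : ℝ) < p.2 := by exact_mod_cast hp.2
    have h3 : (0 : ℝ) < (p.1 : ℝ) ^ (-β₁) * (p.2 : ℝ) ^ (-β₂) := by positivity
    simp only [hf, hbound, Real.norm_eq_abs]
    rw [abs_div, abs_of_pos h3, div_le_iff₀ h3]
    refine (aux_V_le α _ _ hα2 (hcne i j)).trans ?_
    have hy : |c (i + p.1) (j + p.2)| ≤ W * ((p.1 : ℝ) ^ (-β₁) * (p.2 : ℝ) ^ (-β₂)) := by
      have k1 : (0 : ℝ) < (1 + ((i + p.1 : ℕ) : ℝ)) ^ (-β₁) := by positivity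
      have k2 : (0 : ℝ) < (1 + ((j + p.2 : ℕ) : ℝ)) ^ (-β₂) := by positivity
      rw [hc, abs_mul, abs_mul, abs_of_pos k1, abs_of_pos k2, mul_assoc]
      exact mul_le_mul (hW _ _) (mul_le_mul (aux_le β₁ hp1 i _ hp.1) (aux_le β₂ hp2 j _ hp.2)
        k2.le (by positivity)) (by positivity) hW0
    have hx : |c i j| ^ (α - 1) ≤ W ^ (α - 1) * ((1 + (i : ℝ)) ^ (-(β₁ * (α - 1))) *
        (1 + (j : ℝ)) ^ (-(β₂ * (α - 1)))) := by
      rw [hcabs, mul_assoc]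
      exact mul_le_mul_of_nonneg_right (Real.rpow_le_rpow (abs_nonneg _) (hW i j) ha.le)
        (by positivity)
    refine (mul_le_mul hx hy (abs_nonneg _) (by positivity)).trans (le_of_eq ?_)
    ring
  have hgs : Summable g := by
    refine Summable.of_norm_bounded hbs fun q => ?_
    exact le_of_tendsto (hlim q).norm (hle.mono fun p hp => hp q)
  have main := tendsto_tsum_of_dominated_convergence hbs hlim hle
  rw [hgs.tsum_prod] at main
  refine main.congr' ?_
  filter_upwards [hge1] with p hp
  rw [hρ _ _ hp.1 hp.2, ← (hsum _ _ hp.1 hp.2).tsum_prod, ← tsum_div_const]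
end

section
/- Assume either 1 < α ≤ 2 with 1/α < β₁ < 1/(α−1) and 1/α < β₂ < 1/(α−1), or 0 < α ≤ 1 with β₁ > 1/α and β₂ > 1/α. Then the doubly-indexed limit, as n → ∞ and m → ∞ (along the product filter), of ρ(n,m)/(n^{1−αβ₁} m^{1−αβ₂}) exists and equals the (finite) integral ∫₀^∞ ∫₀^∞ V(t^{−β₁} s^{−β₂}, (t+1)^{−β₁} (s+1)^{−β₂}) dt ds. -/
open Filter MeasureTheory Real Set

lemma V_eq (α x y : ℝ) : V α x y = x * y / (x ^ 2 + y ^ 2) ^ ((2 - α) / 2) := by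
  unfold V
  split_ifs with h
  · simp [h.1]
  · rfl

lemma V_bound {α a b w w' M : ℝ} (hα : α ≤ 2) (ha : 0 < a) (hb : 0 < b) (hw : w ≠ 0)
    (h1 : |w| + |w|⁻¹ ≤ M) (h2 : |w'| + |w'|⁻¹ ≤ M) :
    |V α (w * a) (w' * b)| ≤ M ^ 2 * M ^ (2 - α) * (a ^ (α - 1) * b) := by
  have hw0 : 0 < |w| := abs_pos.mpr hw
  have hwi : 0 < |w|⁻¹ := inv_pos.mpr hw0
  have hM : 0 < M := by linarith
  have hw1 : |w| ≤ M := by linarith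
  have hw2 : M⁻¹ ≤ |w| := by
    rw [inv_le_comm₀ hM hw0]; linarith
  have hw'1 : |w'| ≤ M := by
    have : 0 ≤ |w'|⁻¹ := by positivity
    linarith
  rw [V_eq, abs_div]
  have hden : (M⁻¹ * a) ^ (2 - α) ≤ ((w * a) ^ 2 + (w' * b) ^ 2) ^ ((2 - α) / 2) := by
    have e : (M⁻¹ * a) ^ (2 - α) = ((M⁻¹ * a) ^ 2) ^ ((2 - α) / 2) := by
      rw [← Real.rpow_natCast, ← Real.rpow_mul (by positivity)]
      congr 1; push_cast; ring
    rw [e]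
    apply Real.rpow_le_rpow (by positivity) _ (by linarith)
    have : (M⁻¹ * a) ^ 2 ≤ (|w| * a) ^ 2 := by gcongr
    rw [mul_pow |w|, sq_abs, ← mul_pow] at this
    nlinarith [sq_nonneg (w' * b)]
  have hpos : 0 < (M⁻¹ * a) ^ (2 - α) := by positivity
  rw [abs_of_pos (lt_of_lt_of_le hpos hden)]
  have hnum : |w * a * (w' * b)| ≤ M ^ 2 * (a * b) := by
    rw [abs_mul, abs_mul, abs_mul, abs_of_pos ha, abs_of_pos hb]
    calc |w| * a * (|w'| * b) = |w| * |w'| * (a * b) := by ring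
      _ ≤ M * M * (a * b) := by gcongr
      _ = _ := by ring
  calc _ ≤ M ^ 2 * (a * b) / (M⁻¹ * a) ^ (2 - α) := by gcongr
    _ = _ := by
      rw [Real.mul_rpow (by positivity) ha.le, Real.inv_rpow hM.le]
      have : a ^ (α - 1) * a ^ (2 - α) = a := by
        rw [← Real.rpow_add ha]; ring_nf; simp
      have hp : 0 < M ^ (2 - α) := by positivity
      have hp' : 0 < a ^ (2 - α) := by positivity
      field_simp
      linear_combination -this

lemma V_hom {α x y l : ℝ} (hl : 0 < l) : V α (l * x) (l * y) = l ^ α * V α x y := by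
  rw [V_eq, V_eq]
  have : (l * x) ^ 2 + (l * y) ^ 2 = l ^ 2 * (x ^ 2 + y ^ 2) := by ring
  rw [this, Real.mul_rpow (by positivity) (by positivity)]
  have e : (l ^ 2) ^ ((2 - α) / 2) = l ^ (2 - α) := by
    rw [← Real.rpow_natCast, ← Real.rpow_mul (by positivity)]
    congr 1; push_cast; ring
  rw [e]
  have h2 : l ^ α * l ^ (2 - α) = l ^ 2 := by
    rw [← Real.rpow_add hl, ← Real.rpow_natCast]; congr 1; push_cast; ring
  have hp : 0 < l ^ (2 - α) := by positivity
  have h3 : l ^ α = l ^ 2 / l ^ (2 - α) := by field_simp; exact h2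
  rw [h3]
  field_simp

lemma V_cont {α a b : ℝ} (ha : 0 < a) : ContinuousAt (fun p : ℝ × ℝ => V α p.1 p.2) (a, b) := by
  simp only [V_eq]
  have h : (a ^ 2 + b ^ 2) ≠ 0 := by positivity
  have h' : (a ^ 2 + b ^ 2) ^ ((2 - α) / 2) ≠ 0 := by positivity
  refine ContinuousAt.div (by fun_prop) ?_ h'
  exact ContinuousAt.rpow_const (by fun_prop) (Or.inl h)

lemma V_meas (α : ℝ) : Measurable (fun p : ℝ × ℝ => V α p.1 p.2) := by
  simp only [V_eq]
  fun_prop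

lemma seq_bdd (u : ℕ → ℝ) (L : ℝ) (hL : 0 < L) (h : Tendsto u atTop (nhds L)) :
    ∃ M, 0 ≤ M ∧ ∀ j, |u j| + |u j|⁻¹ ≤ M := by
  have h2 : Tendsto (fun j => |u j| + |u j|⁻¹) atTop (nhds (|L| + |L|⁻¹)) :=
    h.abs.add (h.abs.inv₀ (by positivity))
  obtain ⟨M, hM⟩ := h2.bddAbove_range
  refine ⟨M, ?_, fun j => hM ⟨j, rfl⟩⟩
  exact le_trans (by positivity) (hM ⟨0, rfl⟩)

lemma w_bdd (w : ℕ → ℕ → ℝ)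
    (hA1 : Tendsto (fun p : ℕ × ℕ => w p.1 p.2) (atTop ×ˢ atTop) (nhds 1))
    (winf : ℕ → ℝ)
    (hA2 : ∀ i, Tendsto (fun j => w i j) atTop (nhds (winf i)) ∧ 0 < winf i)
    (wco : ℕ → ℝ)
    (hA3 : ∀ j, Tendsto (fun i => w i j) atTop (nhds (wco j)) ∧ 0 < wco j) :
    ∃ M, ∀ i j, |w i j| + |w i j|⁻¹ ≤ M := by
  choose A hA hA' using fun i => seq_bdd (fun j => w i j) _ (hA2 i).2 (hA2 i).1
  choose B hB hB' using fun j => seq_bdd (fun i => w i j) _ (hA3 j).2 (hA3 j).1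
  have h2 : Tendsto (fun p : ℕ × ℕ => |w p.1 p.2| + |w p.1 p.2|⁻¹) (atTop ×ˢ atTop)
      (nhds (|1| + |1|⁻¹)) := hA1.abs.add (hA1.abs.inv₀ (by positivity))
  have h3 := h2.eventually_le_const (show |(1:ℝ)| + |1|⁻¹ < 3 by norm_num)
  rw [prod_atTop_atTop_eq, eventually_atTop] at h3
  obtain ⟨⟨N, N'⟩, h3⟩ := h3
  have sA : 0 ≤ ∑ i ∈ Finset.range N, A i := Finset.sum_nonneg fun i _ => hA i
  have sB : 0 ≤ ∑ i ∈ Finset.range N', B i := Finset.sum_nonneg fun i _ => hB i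
  refine ⟨3 + ∑ i ∈ Finset.range N, A i + ∑ i ∈ Finset.range N', B i, fun i j => ?_⟩
  by_cases hi : i < N
  · have := Finset.single_le_sum (f := A) (fun i _ => hA i) (Finset.mem_range.mpr hi)
    linarith [hA' i j]
  by_cases hj : j < N'
  · have := Finset.single_le_sum (f := B) (fun i _ => hB i) (Finset.mem_range.mpr hj)
    linarith [hB' j i]
  have := h3 (i, j) ⟨by simpa using hi, by simpa using hj⟩
  simp only at this
  linarith

lemma dom (α β : ℝ) (h : (1 < α ∧ 1 / α < β ∧ β < 1 / (α - 1)) ∨ (0 < α ∧ α ≤ 1 ∧ 1 / α < β)) :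
    ∃ G : ℝ → ℝ, IntegrableOn G (Ioi 0) ∧
      ∀ u t : ℝ, 0 < u → u ≤ t → (t ^ (-β)) ^ (α - 1) * (t + 1) ^ (-β) ≤ G u := by
  rcases h with ⟨h1, h2, h3⟩ | ⟨h1, h2, h3⟩
  · have hβ : 0 < β := lt_trans (by positivity) h2
    have hb1 : 1 < α * β := by
      rw [div_lt_iff₀ (by linarith)] at h2; linarith
    have hb2 : β * (α - 1) < 1 := by
      rwa [lt_div_iff₀ (by linarith)] at h3
    refine ⟨fun u => u ^ (-(β * (α - 1))) * (u + 1) ^ (-β), ?_, ?_⟩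
    · rw [← Ioc_union_Ioi_eq_Ioi (zero_le_one' ℝ)]
      refine IntegrableOn.union ?_ ?_
      · have := (intervalIntegral.intervalIntegrable_rpow' (a := 0) (b := 1)
          (r := -(β * (α - 1))) (by linarith))
        rw [intervalIntegrable_iff_integrableOn_Ioc_of_le zero_le_one] at this
        refine Integrable.mono' this (by fun_prop) ?_
        filter_upwards [ae_restrict_mem measurableSet_Ioc] with u hu
        have hu0 : 0 < u := hu.1
        rw [Real.norm_of_nonneg (by positivity)]
        refine mul_le_of_le_one_right (by positivity) ?_
        exact Real.rpow_le_one_of_one_le_of_nonpos (by linarith) (by linarith)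
      · have := integrableOn_Ioi_rpow_of_lt (a := -(α * β)) (c := 1) (by linarith) one_pos
        refine Integrable.mono' this (by fun_prop) ?_
        filter_upwards [ae_restrict_mem measurableSet_Ioi] with u hu
        have hu0 : 0 < u := lt_trans one_pos hu
        rw [Real.norm_of_nonneg (by positivity)]
        calc _ ≤ u ^ (-(β * (α - 1))) * u ^ (-β) := by
              gcongr 1
              exact Real.rpow_le_rpow_of_nonpos hu0 (by linarith) (by linarith)
          _ = _ := by rw [← Real.rpow_add hu0]; ring_nf
    · intro u t hu hut
      have ht : 0 < t := by linarith
      rw [← Real.rpow_mul ht.le]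
      have e : -β * (α - 1) = -(β * (α - 1)) := by ring
      rw [e]
      have : 0 ≤ β * (α - 1) := by
        have : 0 ≤ α - 1 := by linarith
        positivity
      exact mul_le_mul (Real.rpow_le_rpow_of_nonpos hu hut (by linarith))
        (Real.rpow_le_rpow_of_nonpos (by linarith) (by linarith) (by linarith)) (by positivity)
        (by positivity)
  · have hβ : 0 < β := lt_trans (by positivity) h3
    have hb1 : 1 < α * β := by
      rw [div_lt_iff₀ (by linarith)] at h3; linarith
    refine ⟨fun u => (u + 1) ^ (-(α * β)), ?_, ?_⟩
    · exact integrableOn_add_rpow_Ioi_of_lt (by linarith) (by norm_num)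
    · intro u t hu hut
      have ht : 0 < t := by linarith
      rw [← Real.rpow_mul ht.le]
      have h0 : 0 ≤ -β * (α - 1) := by nlinarith
      calc _ ≤ (t + 1) ^ (-β * (α - 1)) * (t + 1) ^ (-β) := by
            gcongr; linarith
        _ = (t + 1) ^ (-(α * β)) := by
            rw [← Real.rpow_add (by linarith)]; ring_nf
        _ ≤ _ := Real.rpow_le_rpow_of_nonpos (by linarith) (by linarith) (by linarith)

lemma floor_meas (n : ℕ) (hn : 1 ≤ n) (i : ℕ) :
    (volume.restrict (Ioi (0:ℝ))) ((fun t : ℝ => ⌊(n:ℝ) * t⌋₊) ⁻¹' {i}) = ENNReal.ofReal (1 / n) := by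
  have hn' : (0:ℝ) < n := by exact_mod_cast hn
  rw [Measure.restrict_congr_set Ioi_ae_eq_Ici]
  have hm : MeasurableSet ((fun t : ℝ => ⌊(n:ℝ) * t⌋₊) ⁻¹' {i}) :=
    (Nat.measurable_floor.comp (measurable_const_mul _)) (measurableSet_singleton i)
  rw [Measure.restrict_apply hm]
  have : (fun t : ℝ => ⌊(n:ℝ) * t⌋₊) ⁻¹' {i} ∩ Ici 0 = Ico ((i:ℝ) / n) ((i + 1 : ℝ) / n) := by
    ext t
    simp only [mem_inter_iff, mem_preimage, mem_singleton_iff, mem_Ici, mem_Ico]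
    constructor
    · rintro ⟨h, ht⟩
      rw [Nat.floor_eq_iff (by positivity)] at h
      rw [div_le_iff₀ hn', lt_div_iff₀ hn']
      constructor <;> nlinarith [h.1, h.2]
    · rintro ⟨h1, h2⟩
      have ht : 0 ≤ t := le_trans (by positivity) h1
      refine ⟨?_, ht⟩
      rw [Nat.floor_eq_iff (by positivity)]
      rw [div_le_iff₀ hn'] at h1
      rw [lt_div_iff₀ hn'] at h2
      constructor <;> nlinarith
  rw [this, Real.volume_Ico]
  congr 1; field_simp; ring

lemma sum_eq_integral (n m : ℕ) (hn : 1 ≤ n) (hm : 1 ≤ m) (f : ℕ × ℕ → ℝ)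
    (hf : Integrable (fun z : ℝ × ℝ => f (⌊(n:ℝ) * z.1⌋₊, ⌊(m:ℝ) * z.2⌋₊))
      ((volume.restrict (Ioi (0:ℝ))).prod (volume.restrict (Ioi (0:ℝ))))) :
    ∫ z, f (⌊(n:ℝ) * z.1⌋₊, ⌊(m:ℝ) * z.2⌋₊)
      ∂((volume.restrict (Ioi (0:ℝ))).prod (volume.restrict (Ioi (0:ℝ))))
      = ∑' q : ℕ × ℕ, (1 / (n:ℝ) * (1 / m)) * f q := by
  set μ := ((volume.restrict (Ioi (0:ℝ))).prod (volume.restrict (Ioi (0:ℝ)))) with hμ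
  let Φ : ℝ × ℝ → ℕ × ℕ := fun z => (⌊(n:ℝ) * z.1⌋₊, ⌊(m:ℝ) * z.2⌋₊)
  have hΦ : Measurable Φ := by
    refine Measurable.prodMk ?_ ?_
    · exact Nat.measurable_floor.comp (measurable_fst.const_mul _)
    · exact Nat.measurable_floor.comp (measurable_snd.const_mul _)
  have hfm : Measurable f := measurable_of_countable f
  have h1 : ∫ z, f (Φ z) ∂μ = ∫ q, f q ∂(μ.map Φ) :=
    (integral_map hΦ.aemeasurable hfm.aestronglyMeasurable).symm
  have h2 : Integrable f (μ.map Φ) :=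
    (integrable_map_measure hfm.aestronglyMeasurable hΦ.aemeasurable).2 hf
  change ∫ z, f (Φ z) ∂μ = _
  rw [h1, integral_countable h2]
  congr 1
  ext ⟨i, j⟩
  have hset : Φ ⁻¹' {(i, j)} = ((fun t : ℝ => ⌊(n:ℝ) * t⌋₊) ⁻¹' {i}) ×ˢ
      ((fun t : ℝ => ⌊(m:ℝ) * t⌋₊) ⁻¹' {j}) := by
    ext z; simp [Φ]
  rw [Measure.real, Measure.map_apply hΦ (measurableSet_singleton _), hset, hμ,
    Measure.prod_prod, floor_meas n hn, floor_meas m hm, ENNReal.toReal_mul,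
    ENNReal.toReal_ofReal (by positivity), ENNReal.toReal_ofReal (by positivity), smul_eq_mul]

lemma c_scale {α β₁ β₂ : ℝ} {w : ℕ → ℕ → ℝ} {c : ℕ → ℕ → ℝ}
    (hc : ∀ i j, c i j = w i j * (1 + (i : ℝ)) ^ (-β₁) * (1 + (j : ℝ)) ^ (-β₂))
    (n m : ℕ) (hn : 1 ≤ n) (hm : 1 ≤ m) (i j : ℕ) :
    ((n:ℝ) ^ (α * β₁) * (m:ℝ) ^ (α * β₂)) * V α (c i j) (c (i + n) (j + m)) =
    V α (w i j * (((1 + i : ℝ) / n) ^ (-β₁) * ((1 + j : ℝ) / m) ^ (-β₂)))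
      (w (i + n) (j + m) * (((1 + i : ℝ) / n + 1) ^ (-β₁) * ((1 + j : ℝ) / m + 1) ^ (-β₂))) := by
  have hn' : (0:ℝ) < n := by exact_mod_cast hn
  have hm' : (0:ℝ) < m := by exact_mod_cast hm
  have e : (n:ℝ) ^ (α * β₁) * (m:ℝ) ^ (α * β₂) = ((n:ℝ) ^ β₁ * (m:ℝ) ^ β₂) ^ α := by
    rw [Real.mul_rpow (by positivity) (by positivity), ← Real.rpow_mul hn'.le,
      ← Real.rpow_mul hm'.le, mul_comm α, mul_comm α]
  rw [e, ← V_hom (by positivity), hc, hc]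
  have k : ∀ (x y β : ℝ), 0 < x → 0 < y → (x / y) ^ (-β) = y ^ β * x ^ (-β) := by
    intro x y β hx hy
    rw [Real.div_rpow hx.le hy.le, Real.rpow_neg hy.le]
    field_simp
  have a1 : (1 + i : ℝ) / n + 1 = (1 + ((i + n : ℕ) : ℝ)) / n := by
    push_cast; field_simp; ring
  have a2 : (1 + j : ℝ) / m + 1 = (1 + ((j + m : ℕ) : ℝ)) / m := by
    push_cast; field_simp; ring
  rw [a1, a2, k _ _ _ (by positivity) hn', k _ _ _ (by positivity) hn',
    k _ _ _ (by positivity) hm', k _ _ _ (by positivity) hm']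
  congr 1 <;> ring

lemma floor_lim {t : ℝ} (ht : 0 < t) :
    Tendsto (fun n : ℕ => (1 + (⌊(n:ℝ) * t⌋₊ : ℝ)) / n) atTop (nhds t) := by
  have h1 := (tendsto_nat_floor_mul_div_atTop ht.le).comp (tendsto_natCast_atTop_atTop (R := ℝ))
  have h2 := (tendsto_one_div_atTop_nhds_zero_nat (𝕜 := ℝ)).add h1
  rw [zero_add] at h2
  refine h2.congr fun n => ?_
  simp only [Function.comp]
  rw [mul_comm t, add_div]

lemma floor_top {t : ℝ} (ht : 0 < t) :
    Tendsto (fun n : ℕ => ⌊(n:ℝ) * t⌋₊) atTop atTop :=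
  tendsto_nat_floor_atTop.comp ((tendsto_natCast_atTop_atTop (R := ℝ)).atTop_mul_const ht)

lemma floor_ge {t : ℝ} (n : ℕ) (hn : 1 ≤ n) : t ≤ (1 + (⌊(n:ℝ) * t⌋₊ : ℝ)) / n := by
  have hn' : (0:ℝ) < n := by exact_mod_cast hn
  rw [le_div_iff₀ hn']
  have := Nat.lt_floor_add_one ((n:ℝ) * t)
  nlinarith

theorem stmt1 (α β₁ β₂ : ℝ)
    (hcond : (1 < α ∧ α ≤ 2 ∧ 1 / α < β₁ ∧ β₁ < 1 / (α - 1) ∧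
        1 / α < β₂ ∧ β₂ < 1 / (α - 1)) ∨
      (0 < α ∧ α ≤ 1 ∧ 1 / α < β₁ ∧ 1 / α < β₂))
    (w : ℕ → ℕ → ℝ) (hw : ∀ i j, w i j ≠ 0)
    (hA1 : Tendsto (fun p : ℕ × ℕ => w p.1 p.2) (atTop ×ˢ atTop) (nhds 1))
    (winf : ℕ → ℝ)
    (hA2 : ∀ i, Tendsto (fun j => w i j) atTop (nhds (winf i)) ∧ 0 < winf i)
    (wco : ℕ → ℝ)
    (hA3 : ∀ j, Tendsto (fun i => w i j) atTop (nhds (wco j)) ∧ 0 < wco j)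
    (c : ℕ → ℕ → ℝ)
    (hc : ∀ i j, c i j = w i j * (1 + (i : ℝ)) ^ (-β₁) * (1 + (j : ℝ)) ^ (-β₂))
    (ρ : ℕ → ℕ → ℝ)
    (hsum : ∀ n m : ℕ, 1 ≤ n → 1 ≤ m →
      Summable (fun q : ℕ × ℕ => V α (c q.1 q.2) (c (q.1 + n) (q.2 + m))))
    (hρ : ∀ n m : ℕ, 1 ≤ n → 1 ≤ m →
      ρ n m = ∑' i : ℕ, ∑' j : ℕ, V α (c i j) (c (i + n) (j + m)))
    :
    Tendsto (fun p : ℕ × ℕ => ρ p.1 p.2 / ((p.1 : ℝ) ^ (1 - α * β₁) * (p.2 : ℝ) ^ (1 - α * β₂)))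
      (atTop ×ˢ atTop)
      (nhds (∫ t in Ioi (0 : ℝ), ∫ s in Ioi (0 : ℝ),
        V α (t ^ (-β₁) * s ^ (-β₂)) ((t + 1) ^ (-β₁) * (s + 1) ^ (-β₂)))) := by
  have hα : α ≤ 2 := by rcases hcond with h | h <;> linarith [h.2.1]
  have hd1 : (1 < α ∧ 1 / α < β₁ ∧ β₁ < 1 / (α - 1)) ∨ (0 < α ∧ α ≤ 1 ∧ 1 / α < β₁) := by
    tauto
  have hd2 : (1 < α ∧ 1 / α < β₂ ∧ β₂ < 1 / (α - 1)) ∨ (0 < α ∧ α ≤ 1 ∧ 1 / α < β₂) := by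
    tauto
  obtain ⟨G₁, hG₁, hb₁⟩ := dom α β₁ hd1
  obtain ⟨G₂, hG₂, hb₂⟩ := dom α β₂ hd2
  obtain ⟨M, hM⟩ := w_bdd w hA1 winf hA2 wco hA3
  set μ := ((volume.restrict (Ioi (0:ℝ))).prod (volume.restrict (Ioi (0:ℝ)))) with hμ
  have hpos : ∀ᵐ z ∂μ, 0 < z.1 ∧ 0 < z.2 := by
    rw [hμ, Measure.prod_restrict]
    filter_upwards [ae_restrict_mem (measurableSet_Ioi.prod measurableSet_Ioi)] with z hz
    exact hz
  -- domination
  have key : ∀ (M' v v' u s x y : ℝ), v ≠ 0 → |v| + |v|⁻¹ ≤ M' → |v'| + |v'|⁻¹ ≤ M' →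
      0 < u → 0 < s → u ≤ x → s ≤ y →
      |V α (v * (x ^ (-β₁) * y ^ (-β₂))) (v' * ((x + 1) ^ (-β₁) * (y + 1) ^ (-β₂)))| ≤
        M' ^ 2 * M' ^ (2 - α) * (G₁ u * G₂ s) := by
    intro M' v v' u s x y hv h1 h2 hu hs hux hsy
    have hx : 0 < x := by linarith
    have hy : 0 < y := by linarith
    have hM' : 0 ≤ M' := le_trans (by positivity) h1
    refine (V_bound hα (by positivity) (by positivity) hv h1 h2).trans ?_
    refine mul_le_mul_of_nonneg_left ?_ (by positivity)
    rw [Real.mul_rpow (by positivity) (by positivity)]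
    calc _ = ((x ^ (-β₁)) ^ (α - 1) * (x + 1) ^ (-β₁)) *
          ((y ^ (-β₂)) ^ (α - 1) * (y + 1) ^ (-β₂)) := by ring
      _ ≤ _ := mul_le_mul (hb₁ u x hu hux) (hb₂ s y hs hsy) (by positivity)
          (le_trans (by positivity) (hb₁ u x hu hux))
  have hGint : ∀ C : ℝ, Integrable (fun z : ℝ × ℝ => C * (G₁ z.1 * G₂ z.2)) μ := fun C =>
    (Integrable.mul_prod hG₁ hG₂).const_mul C
  -- the limit integral
  have hlim_int : Integrable (fun z : ℝ × ℝ =>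
      V α (z.1 ^ (-β₁) * z.2 ^ (-β₂)) ((z.1 + 1) ^ (-β₁) * (z.2 + 1) ^ (-β₂))) μ := by
    refine Integrable.mono' (hGint (2 ^ 2 * 2 ^ (2 - α))) ?_ ?_
    · refine Measurable.aestronglyMeasurable ?_
      exact (V_meas α).comp (Measurable.prodMk (by fun_prop) (by fun_prop))
    · filter_upwards [hpos] with z hz
      have := key 2 1 1 z.1 z.2 z.1 z.2 one_ne_zero (by norm_num) (by norm_num) hz.1 hz.2
        le_rfl le_rfl
      simpa only [one_mul, Real.norm_eq_abs] using this
  have hI : (∫ t in Ioi (0 : ℝ), ∫ s in Ioi (0 : ℝ),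
        V α (t ^ (-β₁) * s ^ (-β₂)) ((t + 1) ^ (-β₁) * (s + 1) ^ (-β₂))) =
      ∫ z, V α (z.1 ^ (-β₁) * z.2 ^ (-β₂)) ((z.1 + 1) ^ (-β₁) * (z.2 + 1) ^ (-β₂)) ∂μ :=
    (integral_prod _ hlim_int).symm
  rw [hI]
  -- the step functions
  let f : ℕ × ℕ → ℕ × ℕ → ℝ := fun p q =>
    ((p.1:ℝ) ^ (α * β₁) * (p.2:ℝ) ^ (α * β₂)) * V α (c q.1 q.2) (c (q.1 + p.1) (q.2 + p.2))
  let F : ℕ × ℕ → ℝ × ℝ → ℝ := fun p z => f p (⌊(p.1:ℝ) * z.1⌋₊, ⌊(p.2:ℝ) * z.2⌋₊)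
  have hev : ∀ᶠ p : ℕ × ℕ in atTop ×ˢ atTop, 1 ≤ p.1 ∧ 1 ≤ p.2 :=
    (eventually_ge_atTop 1).prod_mk (eventually_ge_atTop 1)
  have hFm : ∀ p, AEStronglyMeasurable (F p) μ := by
    intro p
    have : Measurable (f p) := measurable_of_countable _
    refine Measurable.aestronglyMeasurable (this.comp ?_)
    refine Measurable.prodMk ?_ ?_
    · exact Nat.measurable_floor.comp (measurable_fst.const_mul _)
    · exact Nat.measurable_floor.comp (measurable_snd.const_mul _)
  have hFb : ∀ p : ℕ × ℕ, 1 ≤ p.1 ∧ 1 ≤ p.2 →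
      ∀ᵐ z ∂μ, ‖F p z‖ ≤ M ^ 2 * M ^ (2 - α) * (G₁ z.1 * G₂ z.2) := by
    intro p hp
    filter_upwards [hpos] with z hz
    simp only [F, f]
    rw [c_scale hc p.1 p.2 hp.1 hp.2]
    exact key M _ _ z.1 z.2 _ _ (hw _ _) (hM _ _) (hM _ _) hz.1 hz.2
      (floor_ge _ hp.1) (floor_ge _ hp.2)
  have hmain : Tendsto (fun p => ∫ z, F p z ∂μ) (atTop ×ˢ atTop) (nhds
      (∫ z, V α (z.1 ^ (-β₁) * z.2 ^ (-β₂)) ((z.1 + 1) ^ (-β₁) * (z.2 + 1) ^ (-β₂)) ∂μ)) := by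
    refine tendsto_integral_filter_of_dominated_convergence
      (fun z => M ^ 2 * M ^ (2 - α) * (G₁ z.1 * G₂ z.2)) (Eventually.of_forall hFm)
      (hev.mono hFb) (hGint _) ?_
    filter_upwards [hpos] with z hz
    obtain ⟨hz1, hz2⟩ := hz
    have f1 : Tendsto (fun p : ℕ × ℕ => (1 + (⌊(p.1:ℝ) * z.1⌋₊ : ℝ)) / p.1) (atTop ×ˢ atTop)
      (nhds z.1) := (floor_lim hz1).comp tendsto_fst
    have f2 : Tendsto (fun p : ℕ × ℕ => (1 + (⌊(p.2:ℝ) * z.2⌋₊ : ℝ)) / p.2) (atTop ×ˢ atTop)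
      (nhds z.2) := (floor_lim hz2).comp tendsto_snd
    have t1 : Tendsto (fun p : ℕ × ℕ => ⌊(p.1:ℝ) * z.1⌋₊) (atTop ×ˢ atTop) atTop :=
      (floor_top hz1).comp tendsto_fst
    have t2 : Tendsto (fun p : ℕ × ℕ => ⌊(p.2:ℝ) * z.2⌋₊) (atTop ×ˢ atTop) atTop :=
      (floor_top hz2).comp tendsto_snd
    have g1 := hA1.comp (t1.prodMk t2)
    have t1' : Tendsto (fun p : ℕ × ℕ => ⌊(p.1:ℝ) * z.1⌋₊ + p.1) (atTop ×ˢ atTop) atTop :=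
      tendsto_atTop_mono (fun _ => Nat.le_add_right _ _) t1
    have t2' : Tendsto (fun p : ℕ × ℕ => ⌊(p.2:ℝ) * z.2⌋₊ + p.2) (atTop ×ˢ atTop) atTop :=
      tendsto_atTop_mono (fun _ => Nat.le_add_right _ _) t2
    have g2 := hA1.comp (t1'.prodMk t2')
    have a1 := g1.mul ((f1.rpow_const (p := -β₁) (Or.inl hz1.ne')).mul
      (f2.rpow_const (p := -β₂) (Or.inl hz2.ne')))
    have a2 := g2.mul (((f1.add_const 1).rpow_const (p := -β₁) (Or.inl (by positivity))).mul
      ((f2.add_const 1).rpow_const (p := -β₂) (Or.inl (by positivity))))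
    rw [one_mul] at a1 a2
    have hc1 := (V_cont (α := α) (a := z.1 ^ (-β₁) * z.2 ^ (-β₂))
      (b := (z.1 + 1) ^ (-β₁) * (z.2 + 1) ^ (-β₂)) (by positivity)).tendsto.comp
      (a1.prodMk_nhds a2)
    refine hc1.congr' ?_
    filter_upwards [hev] with p hp
    simp only [F, f]
    rw [c_scale hc p.1 p.2 hp.1 hp.2]
    rfl
  refine hmain.congr' ?_
  filter_upwards [hev] with p hp
  have hFi : Integrable (F p) μ := Integrable.mono' (hGint _) (hFm p) (hFb p hp)
  have hn' : (0:ℝ) < p.1 := by exact_mod_cast hp.1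
  have hm' : (0:ℝ) < p.2 := by exact_mod_cast hp.2
  have := sum_eq_integral p.1 p.2 hp.1 hp.2 (f p) hFi
  rw [show ∫ z, F p z ∂μ = _ from this, hρ p.1 p.2 hp.1 hp.2,
    ← (hsum p.1 p.2 hp.1 hp.2).tsum_prod, ← tsum_div_const]
  congr 1
  ext q
  simp only [f]
  rw [Real.rpow_sub hn', Real.rpow_sub hm', Real.rpow_one, Real.rpow_one]
  field_simp
end
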